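/- arXiv:1908.08273 — 3 statements merged into one kernel-verified Lean document; each statement's English description precedes it below -/
import Mathlib

section
/- For every integer n ≥ 3 there exist n pairwise distinct lines ℓ_1, …, ℓ_n in ℝ² (one-dimensional affine subspaces) and points p_{i,j} = p_{j,i} ∈ ℝ² for i ≠ j, with all points p_{i,j} (over unordered pairs {i,j}) pairwise distinct and ℓ_i ∩ ℓ_j = {p_{i,j}} for all i ≠ j, such that: (A1) for every i, the points p_{i,1}, …, p_{i,i−1}, p_{i,i+1}, …, p_{i,n} lie on ℓ_i in this order, i.e., whenever three indices j, k, l appear in this sequence in that order, the point p_{i,k} lies on the closed segment from p_{i,j} to p_{i,l}; and (A2) writing d_i(j,k) for the Euclidean distance between p_{i,j} and p_{i,k}, for every i one has d_i(j+2, j+1) ≤ d_i(j+1, j)/2 for all j with 1 ≤ j ≤ i−3, d_i(i+1, i−1) ≤ d_i(i−1, i−2)/2 whenever 3 ≤ i ≤ n−1, d_i(i+2, i+1) ≤ d_i(i+1, i−1)/2 whenever 2 ≤ i ≤ n−2, and d_i(j+2, j+1) ≤ d_i(j+1, j)/2 for all j with i+1 ≤ j ≤ n−2. -/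
/-- The intersection point of the tangents to the parabola `4 y = x ^ 2` at the points with
abscissas `2 s` and `2 t`. -/
noncomputable def tangentPoint (s t : ℝ) : EuclideanSpace ℝ (Fin 2) := !₂[s + t, s * t]

/-- The tangent to the parabola `4 y = x ^ 2` at the point with abscissa `2 s`. -/
noncomputable def tangentLine (s : ℝ) : AffineSubspace ℝ (EuclideanSpace ℝ (Fin 2)) :=
  AffineSubspace.mk' !₂[s, 0] (Submodule.span ℝ {!₂[1, s]})

lemma finrank_direction_tangentLine (s : ℝ) :
    Module.finrank ℝ (tangentLine s).direction = 1 := by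
  rw [tangentLine, AffineSubspace.direction_mk']
  refine finrank_span_singleton fun h => ?_
  have := congrArg (fun v => v 0) h
  simp at this

lemma mem_tangentLine {s : ℝ} {x : EuclideanSpace ℝ (Fin 2)} :
    x ∈ tangentLine s ↔ x 1 = s * (x 0 - s) := by
  rw [tangentLine, AffineSubspace.mem_mk', Submodule.mem_span_singleton]
  constructor
  · rintro ⟨c, hc⟩
    have h0 := congrArg (fun v => v 0) hc
    have h1 := congrArg (fun v => v 1) hc
    simp at h0 h1
    rw [← h0, ← h1, mul_comm]
  · intro h
    refine ⟨x 0 - s, ?_⟩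
    ext i
    fin_cases i <;> simp [h, mul_comm]

lemma tangentPoint_comm (s t : ℝ) : tangentPoint s t = tangentPoint t s := by
  rw [tangentPoint, tangentPoint, add_comm, mul_comm]

lemma tangentLine_inter {s t : ℝ} (h : s ≠ t) :
    (tangentLine s : Set (EuclideanSpace ℝ (Fin 2))) ∩ tangentLine t = {tangentPoint s t} := by
  ext x
  simp only [Set.mem_inter_iff, SetLike.mem_coe, mem_tangentLine, Set.mem_singleton_iff]
  constructor
  · rintro ⟨hs, ht⟩
    have h0 : x 0 = s + t := mul_left_cancel₀ (sub_ne_zero.2 h) (by linear_combination ht - hs)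
    have h1 : x 1 = s * t := by rw [hs, h0]; ring
    ext i
    fin_cases i <;> simp [tangentPoint, h0, h1]
  · rintro rfl
    simp [tangentPoint, mul_comm]

lemma tangentLine_injective : Function.Injective tangentLine := by
  intro s t h
  have h0 : tangentPoint s s ∈ tangentLine t := by
    rw [← h, mem_tangentLine]; simp [tangentPoint]
  rw [mem_tangentLine] at h0
  simp only [tangentPoint, PiLp.toLp_apply, Matrix.cons_val_zero, Matrix.cons_val_one] at h0
  have : (s - t) ^ 2 = 0 := by linear_combination h0
  exact sub_eq_zero.1 (pow_eq_zero_iff two_ne_zero |>.1 this)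

lemma eq_or_eq_of_tangentPoint_eq {s t u v : ℝ} (h : tangentPoint s t = tangentPoint u v) :
    s = u ∧ t = v ∨ s = v ∧ t = u := by
  have h0 := congrArg (fun x => x 0) h
  have h1 := congrArg (fun x => x 1) h
  simp only [tangentPoint, PiLp.toLp_apply, Matrix.cons_val_zero, Matrix.cons_val_one] at h0 h1
  have : (s - u) * (s - v) = 0 := by linear_combination s * h0 - h1
  rcases mul_eq_zero.1 this with h | h
  · left; constructor <;> linarith
  · right; constructor <;> linarith

lemma tangentPoint_eq_add_smul (s t : ℝ) :
    tangentPoint s t = !₂[s, 0] + t • !₂[1, s] := by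
  ext i
  fin_cases i <;> simp [tangentPoint, mul_comm]

lemma dist_tangentPoint (s t u : ℝ) :
    dist (tangentPoint s t) (tangentPoint s u) = |t - u| * ‖!₂[1, s]‖ := by
  rw [tangentPoint_eq_add_smul, tangentPoint_eq_add_smul, dist_add_left, dist_eq_norm,
    ← sub_smul, norm_smul, Real.norm_eq_abs]

lemma dist_tangentPoint_le {s t u v w : ℝ} (h : |t - u| ≤ |v - w| / 2) :
    dist (tangentPoint s t) (tangentPoint s u) ≤
      dist (tangentPoint s v) (tangentPoint s w) / 2 := by
  rw [dist_tangentPoint, dist_tangentPoint, mul_div_right_comm]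
  gcongr

lemma tangentPoint_mem_segment {s t u v : ℝ} (h : u ∈ segment ℝ t v) :
    tangentPoint s u ∈ segment ℝ (tangentPoint s t) (tangentPoint s v) := by
  obtain ⟨a, b, ha, hb, hab, rfl⟩ := h
  refine ⟨a, b, ha, hb, hab, ?_⟩
  obtain rfl : b = 1 - a := by linarith
  ext i
  fin_cases i <;> simp [tangentPoint] <;> ring


/-- For every `n ≥ 3` there exists an arrangement of `n` pairwise distinct
lines `ℓ 1, …, ℓ n` in `ℝ²` (one-dimensional affine subspaces), together with intersection
points `p i j = p j i` (pairwise distinct over unordered pairs, with `ℓ i ∩ ℓ j = {p i j}`),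
such that (A1) on each line `ℓ i` the points `p i j` appear in the order of increasing `j`
(skipping `j = i`), and (A2) the distances between consecutive intersection points on `ℓ i`
decrease geometrically as in Lemma 1 of the paper. -/
theorem grid_lemma (n : ℕ) (hn : 3 ≤ n) :
    ∃ (ℓ : ℕ → AffineSubspace ℝ (EuclideanSpace ℝ (Fin 2)))
      (p : ℕ → ℕ → EuclideanSpace ℝ (Fin 2)),
      -- each ℓ i is a line (one-dimensional affine subspace)
      (∀ i, 1 ≤ i → i ≤ n → Module.finrank ℝ (ℓ i).direction = 1) ∧
      -- the lines are pairwise distinct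
      (∀ i j, 1 ≤ i → i ≤ n → 1 ≤ j → j ≤ n → i ≠ j → ℓ i ≠ ℓ j) ∧
      -- symmetry of the points
      (∀ i j, 1 ≤ i → i ≤ n → 1 ≤ j → j ≤ n → i ≠ j → p i j = p j i) ∧
      -- points over distinct unordered pairs are distinct
      (∀ i j k l, 1 ≤ i → i ≤ n → 1 ≤ j → j ≤ n → 1 ≤ k → k ≤ n → 1 ≤ l → l ≤ n →
        i ≠ j → k ≠ l → p i j = p k l → ({i, j} : Set ℕ) = {k, l}) ∧
      -- ℓ i ∩ ℓ j = {p i j}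
      (∀ i j, 1 ≤ i → i ≤ n → 1 ≤ j → j ≤ n → i ≠ j →
        (ℓ i : Set (EuclideanSpace ℝ (Fin 2))) ∩ (ℓ j : Set (EuclideanSpace ℝ (Fin 2)))
          = {p i j}) ∧
      -- (A1): on ℓ i, the points p i 1, …, p i (i-1), p i (i+1), …, p i n occur in this order
      (∀ i j k l, 1 ≤ i → i ≤ n → 1 ≤ j → l ≤ n → j < k → k < l →
        j ≠ i → k ≠ i → l ≠ i → p i k ∈ segment ℝ (p i j) (p i l)) ∧
      -- (A2), first family of inequalities: 1 ≤ j ≤ i - 3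
      (∀ i j, 1 ≤ i → i ≤ n → 1 ≤ j → j + 3 ≤ i →
        dist (p i (j + 2)) (p i (j + 1)) ≤ dist (p i (j + 1)) (p i j) / 2) ∧
      -- (A2), second inequality: 3 ≤ i ≤ n - 1
      (∀ i, 3 ≤ i → i + 1 ≤ n →
        dist (p i (i + 1)) (p i (i - 1)) ≤ dist (p i (i - 1)) (p i (i - 2)) / 2) ∧
      -- (A2), third inequality: 2 ≤ i ≤ n - 2
      (∀ i, 2 ≤ i → i + 2 ≤ n →
        dist (p i (i + 2)) (p i (i + 1)) ≤ dist (p i (i + 1)) (p i (i - 1)) / 2) ∧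
      -- (A2), fourth family of inequalities: i + 1 ≤ j ≤ n - 2
      (∀ i j, 1 ≤ i → i ≤ n → i + 1 ≤ j → j + 2 ≤ n →
        dist (p i (j + 2)) (p i (j + 1)) ≤ dist (p i (j + 1)) (p i j) / 2) := by
  set a : ℕ → ℝ := fun i => (1 / 3) ^ i with ha
  have a_anti : StrictAnti a := pow_right_strictAnti₀ (by norm_num) (by norm_num)
  have a_pos : ∀ k, 0 < a k := fun k => by positivity
  have a_succ : ∀ k, a (k + 1) = a k / 3 := fun k => by rw [ha]; ring
  have a_ne : ∀ {i j}, i ≠ j → a i ≠ a j := fun h => a_anti.injective.ne h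
  have step : ∀ i j, dist (tangentPoint (a i) (a (j + 2))) (tangentPoint (a i) (a (j + 1))) ≤
      dist (tangentPoint (a i) (a (j + 1))) (tangentPoint (a i) (a j)) / 2 := by
    intro i j
    apply dist_tangentPoint_le
    have := a_pos j
    rw [a_succ (j + 1), a_succ j, abs_of_neg (by linarith), abs_of_neg (by linarith)]
    linarith
  refine ⟨fun i => tangentLine (a i), fun i j => tangentPoint (a i) (a j),
    fun i _ _ => finrank_direction_tangentLine _,
    fun i j _ _ _ _ h => tangentLine_injective.ne (a_ne h),
    fun i j _ _ _ _ _ => tangentPoint_comm _ _, ?_,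
    fun i j _ _ _ _ h => tangentLine_inter (a_ne h), ?_,
    fun i j _ _ _ _ => step i j, ?_, ?_, fun i j _ _ _ _ => step i j⟩
  · intro i j k l _ _ _ _ _ _ _ _ _ _ h
    rcases eq_or_eq_of_tangentPoint_eq h with ⟨h₁, h₂⟩ | ⟨h₁, h₂⟩
    · rw [a_anti.injective h₁, a_anti.injective h₂]
    · rw [a_anti.injective h₁, a_anti.injective h₂, Set.pair_comm]
  · intro i j k l _ _ _ _ hjk hkl _ _ _
    apply tangentPoint_mem_segment
    rw [segment_symm, segment_eq_Icc (a_anti (hjk.trans hkl)).le]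
    exact ⟨(a_anti hkl).le, (a_anti hjk).le⟩
  · intro i hi _
    obtain ⟨k, rfl⟩ := Nat.exists_eq_add_of_le' hi
    apply dist_tangentPoint_le
    have := a_pos (k + 1)
    simp only [show k + 3 - 1 = k + 2 by omega,
      show k + 3 - 2 = k + 1 by omega]
    rw [a_succ (k + 3), a_succ (k + 2), a_succ (k + 1), abs_of_neg (by linarith),
      abs_of_neg (by linarith)]
    linarith
  · intro i hi _
    obtain ⟨k, rfl⟩ := Nat.exists_eq_add_of_le' hi
    apply dist_tangentPoint_le
    have := a_pos (k + 1)
    simp only [show k + 2 - 1 = k + 1 by omega]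
    rw [a_succ (k + 2 + 1), a_succ (k + 2), a_succ (k + 1), abs_of_neg (by linarith),
      abs_of_neg (by linarith)]
    linarith
end

section
/- Every finite simple graph G in which every vertex has degree at least 3 admits a contact representation by nondegenerate convex polygons in ℝ³: there is an injective assignment e ↦ p_e of points of ℝ³ to the edges of G such that, writing P_v := conv{p_e : e incident to v} for each vertex v, each P_v is contained in a 2-dimensional affine subspace of ℝ³ and affinely spans that subspace, each p_e with e incident to v is an extreme point of P_v, and for distinct vertices u, v one has P_u ∩ P_v = {p_{uv}} if uv is an edge of G and P_u ∩ P_v = ∅ otherwise. -/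
/-- The height of the contact point of the vertices with indices `i` and `j`. -/
noncomputable def contactHeight (n i j : ℕ) : ℝ :=
  ((max i j : ℕ) : ℝ) * (2 * n : ℝ) ^ max i j +
    (2 * n - ((min i j : ℕ) : ℝ)) * (2 * n : ℝ) ^ min i j

/-- The contact point of the vertices with indices `i` and `j`: a lift of the intersection point
of two tangents of a parabola. -/
noncomputable def contactPoint (n i j : ℕ) : EuclideanSpace ℝ (Fin 3) :=
  !₂[(2 * n : ℝ) ^ i + (2 * n : ℝ) ^ j, (2 * n : ℝ) ^ i * (2 * n : ℝ) ^ j, contactHeight n i j]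

/-- The functional `x ↦ σ * (x 2 - m * x 0)`. -/
noncomputable def tilt (σ m : ℝ) : EuclideanSpace ℝ (Fin 3) →ₗ[ℝ] ℝ where
  toFun x := σ * (x 2 - m * x 0)
  map_add' x y := by simp only [PiLp.add_apply]; ring
  map_smul' c x := by simp only [PiLp.smul_apply, smul_eq_mul, RingHom.id_apply]; ring

/-- The functional `x ↦ x 1 - t * x 0`, constant on the vertical plane above a tangent. -/
noncomputable def tangentForm (t : ℝ) : EuclideanSpace ℝ (Fin 3) →ₗ[ℝ] ℝ where
  toFun x := x 1 - t * x 0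
  map_add' x y := by simp only [PiLp.add_apply]; ring
  map_smul' c x := by simp only [PiLp.smul_apply, smul_eq_mul, RingHom.id_apply]; ring

/-- The side on which the polygon of `i` lies at its contact point with the polygon of `j`. -/
noncomputable def side (i j : ℕ) : ℝ := if i < j then 1 else -1

lemma side_swap {i j : ℕ} (h : i ≠ j) : side j i = -side i j := by
  unfold side
  rcases lt_or_gt_of_ne h with h | h <;> simp [h, h.not_gt]

lemma contactHeight_comm (n i j : ℕ) : contactHeight n i j = contactHeight n j i := by
  simp only [contactHeight, max_comm i j, min_comm i j]

lemma contactHeight_of_lt {n i j : ℕ} (h : i < j) :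
    contactHeight n i j = j * (2 * n : ℝ) ^ j + (2 * n - i) * (2 * n : ℝ) ^ i := by
  simp only [contactHeight, max_eq_right h.le, min_eq_left h.le]

lemma contactHeight_of_gt {n i j : ℕ} (h : j < i) :
    contactHeight n i j = i * (2 * n : ℝ) ^ i + (2 * n - j) * (2 * n : ℝ) ^ j := by
  rw [contactHeight_comm, contactHeight_of_lt h]

lemma contactPoint_comm (n i j : ℕ) : contactPoint n i j = contactPoint n j i := by
  simp only [contactPoint, contactHeight_comm n i j, add_comm ((2 * n : ℝ) ^ i),
    mul_comm ((2 * n : ℝ) ^ i)]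

@[simp] lemma contactPoint_zero (n i j : ℕ) :
    contactPoint n i j 0 = (2 * n : ℝ) ^ i + (2 * n : ℝ) ^ j := rfl

@[simp] lemma contactPoint_one (n i j : ℕ) :
    contactPoint n i j 1 = (2 * n : ℝ) ^ i * (2 * n : ℝ) ^ j := rfl

@[simp] lemma contactPoint_two (n i j : ℕ) : contactPoint n i j 2 = contactHeight n i j := rfl

lemma two_mul_mul_pow_le {n i j : ℕ} (hj : j < n) (h : i < j) :
    (2 * n : ℝ) * (2 * n : ℝ) ^ i ≤ (2 * n : ℝ) ^ j := by
  rw [← pow_succ']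
  have : (1 : ℝ) ≤ n := by exact_mod_cast (by omega : 1 ≤ n)
  exact pow_le_pow_right₀ (by linarith) h

lemma two_mul_pow_pos {n i : ℕ} (hi : i < n) : (0 : ℝ) < (2 * n : ℝ) ^ i := by
  have : (0 : ℝ) < n := by exact_mod_cast (by omega : 0 < n)
  positivity

lemma contactHeight_sub_gt {n s c x : ℕ} (hc : c < n) (hx : x < n) (hsc : s < c)
    (hxs : x ≠ s) (hxc : x ≠ c) :
    ((c : ℝ) + 1) * ((2 * n : ℝ) ^ x - (2 * n : ℝ) ^ c) <
      contactHeight n s x - contactHeight n s c := by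
  have pc := two_mul_pow_pos hc
  have px := two_mul_pow_pos hx
  have ps := two_mul_pow_pos (hsc.trans hc)
  have hcn : (c : ℝ) + 1 ≤ n := by exact_mod_cast hc
  have hxn : (x : ℝ) + 1 ≤ n := by exact_mod_cast hx
  rw [contactHeight_of_lt hsc]
  rcases lt_or_gt_of_ne hxs with h | h
  · rw [contactHeight_of_gt h]
    have h1 := two_mul_mul_pow_le hc hsc
    have h2 : (0 : ℝ) < (2 * n - x - c - 1) * (2 * n : ℝ) ^ x := by
      have : x + c + 1 < 2 * n := by omega
      have : (x : ℝ) + c + 1 < 2 * n := by exact_mod_cast this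
      exact mul_pos (by linarith) px
    have h3 : (0 : ℝ) ≤ s * (2 * n : ℝ) ^ s := by positivity
    nlinarith
  · rw [contactHeight_of_lt h]
    rcases lt_or_gt_of_ne hxc with h' | h'
    · have h1 := two_mul_mul_pow_le hc h'
      have h2 : (0 : ℝ) ≤ x * (2 * n : ℝ) ^ x := by positivity
      nlinarith
    · have h1 : (0 : ℝ) ≤ (x - c - 1) * (2 * n : ℝ) ^ x := by
        have : (c : ℝ) + 1 ≤ x := by exact_mod_cast h'
        exact mul_nonneg (by linarith) px.le
      nlinarith

lemma contactHeight_sub_lt {n s b x : ℕ} (hs : s < n) (hx : x < n) (hbs : b < s)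
    (hxs : x ≠ s) (hxb : x ≠ b) :
    contactHeight n s x - contactHeight n s b <
      ((2 * n : ℝ) - b - 1) * ((2 * n : ℝ) ^ x - (2 * n : ℝ) ^ b) := by
  have pb := two_mul_pow_pos (hbs.trans hs)
  have px := two_mul_pow_pos hx
  have ps := two_mul_pow_pos hs
  have hsn : (s : ℝ) + 1 ≤ n := by exact_mod_cast hs
  have hbn : (b : ℝ) + 1 ≤ s := by exact_mod_cast hbs
  have hxn : (x : ℝ) + 1 ≤ n := by exact_mod_cast hx
  rw [contactHeight_of_gt hbs]
  rcases lt_or_gt_of_ne hxs with h | h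
  · rw [contactHeight_of_gt h]
    rcases lt_or_gt_of_ne hxb with h' | h'
    · have h1 := two_mul_mul_pow_le (hbs.trans hs) h'
      have h2 : (0 : ℝ) ≤ x * (2 * n : ℝ) ^ x := by positivity
      nlinarith
    · have h1 : (0 : ℝ) ≤ (x - b - 1) * (2 * n : ℝ) ^ x := by
        have : (b : ℝ) + 1 ≤ x := by exact_mod_cast h'
        exact mul_nonneg (by linarith) px.le
      nlinarith
  · rw [contactHeight_of_lt h]
    have h1 := two_mul_mul_pow_le hx h
    have h2 : (0 : ℝ) ≤ (2 * n - b - 2 - x) * (2 * n : ℝ) ^ x :=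
      mul_nonneg (by linarith) px.le
    have h3 : (0 : ℝ) ≤ s * (2 * n : ℝ) ^ s := by positivity
    nlinarith

lemma exists_tilt_lt {n i j : ℕ} (hi : i < n) (hj : j < n) (hij : i ≠ j) :
    ∃ m, ∀ k < n, k ≠ i → k ≠ j →
      tilt (side i j) m (contactPoint n i j) < tilt (side i j) m (contactPoint n i k) := by
  rcases lt_or_gt_of_ne hij with h | h
  · refine ⟨j + 1, fun k hk hki hkj ↦ ?_⟩
    have := contactHeight_sub_gt hj hk h hki hkj
    simp only [tilt, side, h, if_true, LinearMap.coe_mk, AddHom.coe_mk, contactPoint_zero,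
      contactPoint_two]
    linarith
  · refine ⟨2 * n - j - 1, fun k hk hki hkj ↦ ?_⟩
    have := contactHeight_sub_lt hi hk h hki hkj
    simp only [tilt, side, h.le.not_gt, if_false, LinearMap.coe_mk, AddHom.coe_mk,
      contactPoint_zero, contactPoint_two]
    linarith

lemma two_mul_pow_inj {n i j : ℕ} (hj : j < n)
    (h : (2 * n : ℝ) ^ i = (2 * n : ℝ) ^ j) : i = j := by
  have : (1 : ℝ) ≤ n := by exact_mod_cast (by omega : 1 ≤ n)
  exact pow_right_injective₀ (by linarith) (by linarith) h

lemma contactPoint_inj {n i j k l : ℕ} (hk : k < n) (hl : l < n)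
    (h : contactPoint n i j = contactPoint n k l) : i = k ∧ j = l ∨ i = l ∧ j = k := by
  have h0 := congrArg (fun x : EuclideanSpace ℝ (Fin 3) ↦ x 0) h
  have h1 := congrArg (fun x : EuclideanSpace ℝ (Fin 3) ↦ x 1) h
  simp only [contactPoint_zero, contactPoint_one] at h0 h1
  have h2 : ((2 * n : ℝ) ^ i - (2 * n : ℝ) ^ k) * ((2 * n : ℝ) ^ i - (2 * n : ℝ) ^ l) = 0 := by
    linear_combination (2 * n : ℝ) ^ i * h0 - h1
  rcases mul_eq_zero.mp h2 with h2 | h2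
  · exact .inl ⟨two_mul_pow_inj hk (by linarith), two_mul_pow_inj hl (by linarith)⟩
  · exact .inr ⟨two_mul_pow_inj hl (by linarith), two_mul_pow_inj hk (by linarith)⟩

section Convexity

variable {E : Type*} [AddCommGroup E] [Module ℝ E]

lemma convex_insert_lt (φ : E →ₗ[ℝ] ℝ) (p : E) : Convex ℝ (insert p {x | φ p < φ x}) := by
  rintro x hx y hy a b ha hb hab
  rcases hx with rfl | hx
  · rcases hy with rfl | hy
    · left; rw [← add_smul, hab, one_smul]
    · rcases hb.eq_or_lt with rfl | hb
      · left; simp_all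
      · right
        simp only [Set.mem_ofPred_eq, map_add, map_smul, smul_eq_mul] at hy ⊢
        linear_combination b * hy - φ x * hab
  · rcases hy with rfl | hy
    · rcases ha.eq_or_lt with rfl | ha
      · left; simp_all
      · right
        simp only [Set.mem_ofPred_eq, map_add, map_smul, smul_eq_mul] at hx ⊢
        linear_combination a * hx - φ y * hab
    · right
      exact convex_halfSpace_gt φ.isLinear (φ p) hx hy ha hb hab

lemma notMem_convexHull_diff_of_forall_lt (φ : E →ₗ[ℝ] ℝ) {p : E} {S : Set E}
    (h : ∀ x ∈ S, x ≠ p → φ p < φ x) : p ∉ convexHull ℝ (convexHull ℝ S \ {p}) := by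
  have hS : convexHull ℝ S ⊆ insert p {x | φ p < φ x} :=
    convexHull_min (fun x hx ↦ or_iff_not_imp_left.mpr (h x hx)) (convex_insert_lt φ p)
  have hD : convexHull ℝ (convexHull ℝ S \ {p}) ⊆ {x | φ p < φ x} :=
    convexHull_min (fun x hx ↦ (hS hx.1).resolve_left hx.2) (convex_halfSpace_gt φ.isLinear _)
  exact fun hp ↦ lt_irrefl (φ p) (hD hp)

lemma linearIndependent_sub_of_forall_exposed {p : Fin 3 → E}
    (h : ∀ i, ∃ φ : E →ₗ[ℝ] ℝ, ∀ j, j ≠ i → φ (p i) < φ (p j)) :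
    LinearIndependent ℝ ![p 1 - p 0, p 2 - p 0] := by
  rw [LinearIndependent.pair_iff]
  intro a b hab
  obtain ⟨φ, hφ⟩ := h 0
  obtain ⟨χ, hχ⟩ := h 1
  obtain ⟨ψ, hψ⟩ := h 2
  have e₀ := congrArg φ hab
  have e₁ := congrArg χ hab
  have e₂ := congrArg ψ hab
  simp only [map_add, map_smul, map_sub, smul_eq_mul, map_zero] at e₀ e₁ e₂
  have a₁ := hφ 1 (by decide)
  have a₂ := hφ 2 (by decide)
  have b₁ := hχ 0 (by decide)
  have b₂ := hχ 2 (by decide)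
  have c₁ := hψ 0 (by decide)
  have c₂ := hψ 1 (by decide)
  have key : a = 0 := by
    rcases lt_trichotomy a 0 with ha | ha | ha
    · have hb : 0 < b := by by_contra hb; nlinarith
      have : 0 < a + b := by by_contra hc; nlinarith
      nlinarith
    · exact ha
    · have hb : b < 0 := by by_contra hb; nlinarith
      have : a + b < 0 := by by_contra hc; nlinarith
      nlinarith
  subst key
  refine ⟨rfl, ?_⟩
  have : b * (φ (p 2) - φ (p 0)) = 0 := by linarith
  exact (mul_eq_zero.mp this).resolve_right (by linarith)

lemma finrank_direction_affineSpan_eq_two [FiniteDimensional ℝ E] (hE : Module.finrank ℝ E = 3)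
    {S : Set E} {ψ : E →ₗ[ℝ] ℝ} {c : ℝ} (hψ : ψ ≠ 0) (hS : ∀ x ∈ S, ψ x = c)
    {p : Fin 3 → E} (hp : ∀ i, p i ∈ S)
    (h : ∀ i, ∃ φ : E →ₗ[ℝ] ℝ, ∀ j, j ≠ i → φ (p i) < φ (p j)) :
    Module.finrank ℝ (affineSpan ℝ S).direction = 2 := by
  rw [direction_affineSpan]
  apply le_antisymm
  · have hle : vectorSpan ℝ S ≤ LinearMap.ker ψ := by
      rw [vectorSpan_def, Submodule.span_le]
      rintro _ ⟨x, hx, y, hy, rfl⟩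
      simp [hS x hx, hS y hy]
    have h1 := Submodule.finrank_mono hle
    have h2 := Module.Dual.finrank_ker_add_one_of_ne_zero (K := ℝ) (f := ψ) hψ
    omega
  · have hli := linearIndependent_sub_of_forall_exposed h
    have hle : Submodule.span ℝ (Set.range ![p 1 - p 0, p 2 - p 0]) ≤ vectorSpan ℝ S := by
      rw [Submodule.span_le]
      rintro _ ⟨i, rfl⟩
      fin_cases i
      · exact vsub_mem_vectorSpan ℝ (hp 1) (hp 0)
      · exact vsub_mem_vectorSpan ℝ (hp 2) (hp 0)
    have h1 := Submodule.finrank_mono hle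
    rwa [finrank_span_eq_card hli, Fintype.card_fin] at h1

end Convexity

lemma tangentForm_contactPoint (n i j : ℕ) :
    tangentForm ((2 * n : ℝ) ^ i) (contactPoint n i j) = -((2 * n : ℝ) ^ i) ^ 2 := by
  simp only [tangentForm, LinearMap.coe_mk, AddHom.coe_mk, contactPoint_zero, contactPoint_one]
  ring

lemma tangentForm_ne_zero (t : ℝ) : tangentForm t ≠ 0 := by
  intro h
  have := LinearMap.congr_fun h !₂[0, 1, 0]
  simp [tangentForm] at this

/-- The contact points of vertex `i` with the vertices in `K`. -/
def contactSet (n i : ℕ) (K : Set ℕ) : Set (EuclideanSpace ℝ (Fin 3)) :=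
  contactPoint n i '' K

lemma tangentForm_of_mem_convexHull {n i : ℕ} {K : Set ℕ} {x : EuclideanSpace ℝ (Fin 3)}
    (hx : x ∈ convexHull ℝ (contactSet n i K)) :
    tangentForm ((2 * n : ℝ) ^ i) x = -((2 * n : ℝ) ^ i) ^ 2 := by
  have hconv := convex_hyperplane (𝕜 := ℝ) (tangentForm ((2 * n : ℝ) ^ i)).isLinear
    (-((2 * n : ℝ) ^ i) ^ 2)
  refine convexHull_min ?_ hconv hx
  rintro _ ⟨j, -, rfl⟩
  exact tangentForm_contactPoint n i j

lemma eq_contactPoint_of_mem_inter {n i j : ℕ} (hi : i < n) (hj : j < n) (hij : i ≠ j)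
    {K L : Set ℕ} (hK : ∀ k ∈ K, k < n ∧ k ≠ i) (hL : ∀ k ∈ L, k < n ∧ k ≠ j)
    {x : EuclideanSpace ℝ (Fin 3)} (hxK : x ∈ convexHull ℝ (contactSet n i K))
    (hxL : x ∈ convexHull ℝ (contactSet n j L)) : x = contactPoint n i j := by
  have hne : (2 * n : ℝ) ^ i - (2 * n : ℝ) ^ j ≠ 0 :=
    fun h ↦ hij (two_mul_pow_inj hj (by linarith))
  have eK := tangentForm_of_mem_convexHull hxK
  have eL := tangentForm_of_mem_convexHull hxL
  simp only [tangentForm, LinearMap.coe_mk, AddHom.coe_mk] at eK eL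
  have x0 : x 0 = (2 * n : ℝ) ^ i + (2 * n : ℝ) ^ j := by
    apply mul_left_cancel₀ hne
    linear_combination eL - eK
  have hull : ∀ {i j : ℕ} {K : Set ℕ}, i < n → j < n → i ≠ j → (∀ k ∈ K, k < n ∧ k ≠ i) →
      x ∈ convexHull ℝ (contactSet n i K) → x 0 = (2 * n : ℝ) ^ i + (2 * n : ℝ) ^ j →
      x = contactPoint n i j ∨ side i j * contactHeight n i j < side i j * x 2 := by
    intro i j K hi hj hij hK hx x0
    obtain ⟨m, hm⟩ := exists_tilt_lt hi hj hij
    have : x ∈ insert (contactPoint n i j)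
        {y | tilt (side i j) m (contactPoint n i j) < tilt (side i j) m y} := by
      refine convexHull_min ?_ (convex_insert_lt _ _) hx
      rintro _ ⟨k, hk, rfl⟩
      by_cases hkj : k = j
      · exact .inl (hkj ▸ rfl)
      · exact .inr (hm k (hK k hk).1 (hK k hk).2 hkj)
    refine this.imp_right fun h ↦ ?_
    simp only [tilt, LinearMap.coe_mk, AddHom.coe_mk, contactPoint_zero, contactPoint_two,
      Set.mem_ofPred_eq, x0] at h
    linarith
  rcases hull hi hj hij hK hxK x0 with h | h
  · exact h
  rcases hull hj hi hij.symm hL hxL (by rw [x0, add_comm]) with h' | h'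
  · rw [h', contactPoint_comm]
  · rw [side_swap hij, contactHeight_comm] at h'
    linarith

lemma contactPoint_notMem_convexHull {n i j : ℕ} (hi : i < n) (hj : j < n) (hij : i ≠ j)
    {K : Set ℕ} (hK : ∀ k ∈ K, k < n ∧ k ≠ i) (hjK : j ∉ K) :
    contactPoint n i j ∉ convexHull ℝ (contactSet n i K) := by
  obtain ⟨m, hm⟩ := exists_tilt_lt hi hj hij
  intro h
  refine lt_irrefl (tilt (side i j) m (contactPoint n i j)) (convexHull_min ?_ (convex_halfSpace_gt (tilt (side i j) m).isLinear
    (tilt (side i j) m (contactPoint n i j))) h)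
  rintro _ ⟨k, hk, rfl⟩
  exact hm k (hK k hk).1 (hK k hk).2 (fun h ↦ hjK (h ▸ hk))


/-- Every finite simple graph in which every vertex has degree at least 3
admits a contact representation by nondegenerate convex polygons in ℝ³: an injective
assignment `e ↦ p e` of points to the edges such that, writing
`P v = conv {p e : e incident to v}`, each `P v` affinely spans a 2-dimensional affine
subspace, each incident `p e` is an extreme point of `P v`, and for distinct `u, v`,
`P u ∩ P v = {p (uv)}` if `uv` is an edge and `P u ∩ P v = ∅` otherwise. -/
theorem min_degree_three_contact_representation
    {V : Type*} [Fintype V] [DecidableEq V] (G : SimpleGraph V) [DecidableRel G.Adj]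
    (hdeg : ∀ v, 3 ≤ G.degree v) :
    ∃ p : G.edgeSet → EuclideanSpace ℝ (Fin 3),
      Function.Injective p ∧
      -- each P v spans a 2-dimensional affine subspace (nondegenerate polygon)
      (∀ v : V, Module.finrank ℝ
        (affineSpan ℝ {x | ∃ e : G.edgeSet, v ∈ (e : Sym2 V) ∧ x = p e}).direction = 2) ∧
      -- each incident contact point is an extreme point of P v
      (∀ (v : V) (e : G.edgeSet), v ∈ (e : Sym2 V) →
        p e ∉ convexHull ℝ
          ((convexHull ℝ {x | ∃ e' : G.edgeSet, v ∈ (e' : Sym2 V) ∧ x = p e'}) \ {p e})) ∧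
      -- polygons of adjacent vertices meet exactly in the contact point of their edge
      (∀ u v (huv : G.Adj u v),
        convexHull ℝ {x | ∃ e : G.edgeSet, u ∈ (e : Sym2 V) ∧ x = p e} ∩
          convexHull ℝ {x | ∃ e : G.edgeSet, v ∈ (e : Sym2 V) ∧ x = p e} =
          {p ⟨s(u, v), G.mem_edgeSet.mpr huv⟩}) ∧
      -- polygons of distinct non-adjacent vertices are disjoint
      (∀ u v, u ≠ v → ¬ G.Adj u v →
        convexHull ℝ {x | ∃ e : G.edgeSet, u ∈ (e : Sym2 V) ∧ x = p e} ∩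
          convexHull ℝ {x | ∃ e : G.edgeSet, v ∈ (e : Sym2 V) ∧ x = p e} = ∅) := by
  classical
  set n := Fintype.card V with hn
  let ι : V → ℕ := fun v ↦ Fintype.equivFin V v
  have ι_lt : ∀ v, ι v < n := fun v ↦ (Fintype.equivFin V v).isLt
  have ι_inj : Function.Injective ι := Fin.val_injective.comp (Fintype.equivFin V).injective
  let q : Sym2 V → EuclideanSpace ℝ (Fin 3) :=
    Sym2.lift ⟨fun u v ↦ contactPoint n (ι u) (ι v), fun u v ↦ contactPoint_comm _ _ _⟩
  have q_mk : ∀ u v, q s(u, v) = contactPoint n (ι u) (ι v) := fun _ _ ↦ rfl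
  let K : V → Set ℕ := fun v ↦ ι '' {w | G.Adj v w}
  have hK : ∀ v, ∀ k ∈ K v, k < n ∧ k ≠ ι v := by
    rintro v _ ⟨w, hw, rfl⟩
    exact ⟨ι_lt w, fun h ↦ hw.ne' (ι_inj h)⟩
  have hset : ∀ v, {x | ∃ e : G.edgeSet, v ∈ (e : Sym2 V) ∧ x = q e} =
      contactSet n (ι v) (K v) := by
    intro v
    ext x
    constructor
    · rintro ⟨⟨e, he⟩, hv, rfl⟩
      obtain ⟨w, rfl⟩ := Sym2.mem_iff_exists.mp hv
      exact ⟨ι w, ⟨w, he, rfl⟩, rfl⟩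
    · rintro ⟨_, ⟨w, hw, rfl⟩, rfl⟩
      exact ⟨⟨s(v, w), hw⟩, Sym2.mem_mk_left v w, rfl⟩
  have mem_hull : ∀ u v, G.Adj u v →
      contactPoint n (ι u) (ι v) ∈ convexHull ℝ (contactSet n (ι u) (K u)) :=
    fun u v h ↦ subset_convexHull ℝ _ ⟨ι v, ⟨v, h, rfl⟩, rfl⟩
  refine ⟨fun e ↦ q e, ?_, ?_, ?_, ?_, ?_⟩
  · rintro ⟨e, he⟩ ⟨f, hf⟩ h
    induction e with | _ a b
    induction f with | _ c d
    simp only [q_mk] at h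
    apply Subtype.ext
    rcases contactPoint_inj (ι_lt c) (ι_lt d) h with ⟨h1, h2⟩ | ⟨h1, h2⟩
    · simp [ι_inj h1, ι_inj h2]
    · simp [ι_inj h1, ι_inj h2]
  · intro v
    rw [hset]
    obtain ⟨T, hT, hT3⟩ := Finset.exists_subset_card_eq (hdeg v)
    let w : Fin 3 ≃ T := (T.equivFinOfCardEq hT3).symm
    have hadj : ∀ i, G.Adj v (w i) := fun i ↦
      (G.mem_neighborFinset v _).mp (hT (w i).2)
    refine finrank_direction_affineSpan_eq_two (by simp) (tangentForm_ne_zero ((2 * n : ℝ) ^ ι v))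
      (c := -((2 * n : ℝ) ^ ι v) ^ 2) ?_ (p := fun i ↦ contactPoint n (ι v) (ι (w i))) ?_ ?_
    · exact fun x hx ↦ tangentForm_of_mem_convexHull (subset_convexHull ℝ _ hx)
    · exact fun i ↦ ⟨_, ⟨w i, hadj i, rfl⟩, rfl⟩
    · intro i
      obtain ⟨m, hm⟩ := exists_tilt_lt (ι_lt v) (ι_lt (w i)) (fun h ↦ (hadj i).ne (ι_inj h))
      refine ⟨_, fun j hj ↦ hm _ (ι_lt _) (fun h ↦ (hadj j).ne' (ι_inj h)) fun h ↦ hj ?_⟩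
      exact w.injective (Subtype.ext (ι_inj h))
  · rintro v ⟨e, he⟩ hv
    obtain ⟨w, rfl⟩ := Sym2.mem_iff_exists.mp hv
    have hvw : G.Adj v w := he
    rw [hset]
    obtain ⟨m, hm⟩ := exists_tilt_lt (ι_lt v) (ι_lt w) (fun h ↦ hvw.ne (ι_inj h))
    refine notMem_convexHull_diff_of_forall_lt (tilt (side (ι v) (ι w)) m) ?_
    rintro _ ⟨k, hk, rfl⟩ hne
    exact hm k (hK v k hk).1 (hK v k hk).2 (fun h ↦ hne (by simp only [h, q_mk]))
  · intro u v huv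
    rw [hset, hset]
    refine Set.Subset.antisymm ?_ ?_
    · rintro x ⟨hu, hv⟩
      exact eq_contactPoint_of_mem_inter (ι_lt u) (ι_lt v) (fun h ↦ huv.ne (ι_inj h))
        (hK u) (hK v) hu hv
    · rintro _ rfl
      refine ⟨mem_hull u v huv, ?_⟩
      have := mem_hull v u huv.symm
      rwa [contactPoint_comm] at this
  · intro u v huv hadj
    rw [hset, hset, Set.eq_empty_iff_forall_notMem]
    rintro x ⟨hu, hv⟩
    have hne : ι u ≠ ι v := fun h ↦ huv (ι_inj h)
    have hx := eq_contactPoint_of_mem_inter (ι_lt u) (ι_lt v) hne (hK u) (hK v) hu hv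
    refine contactPoint_notMem_convexHull (ι_lt u) (ι_lt v) hne (hK u) ?_ (hx ▸ hu)
    rintro ⟨w, hw, h⟩
    exact hadj (ι_inj h ▸ hw)
end

section
/- There exist nine pairwise distinct points a_{ij} ∈ ℝ³ for i ∈ {1,2,3} and j ∈ {4,5,6} such that: for each i, the three points a_{i4}, a_{i5}, a_{i6} are pairwise at Euclidean distance 1 (so T_i := conv{a_{i4}, a_{i5}, a_{i6}} is a unit equilateral triangle); for each j, the three points a_{1j}, a_{2j}, a_{3j} are pairwise at Euclidean distance 1 (so S_j := conv{a_{1j}, a_{2j}, a_{3j}} is a unit equilateral triangle); T_i ∩ S_j = {a_{ij}} for all i ∈ {1,2,3} and j ∈ {4,5,6}; T_i ∩ T_{i'} = ∅ for i ≠ i'; and S_j ∩ S_{j'} = ∅ for j ≠ j'. (This is a contact representation of K_{3,3} in 3D by unit equilateral triangles.) -/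
/-- Heights of the vertices of a unit equilateral triangle with one vertex at the origin that is
symmetric about a coordinate axis. -/
noncomputable def triangleHeight : Fin 3 → ℝ := ![0, 1 / 2, -1 / 2]

theorem triangleHeight_injective : Function.Injective triangleHeight := by
  intro i j h
  fin_cases i <;> fin_cases j <;> simp [triangleHeight] at h ⊢ <;> norm_num at h

theorem triangleHeight_dist {i j : Fin 3} (h : i ≠ j) :
    3 * (|triangleHeight i| - |triangleHeight j|) ^ 2
      + (triangleHeight i - triangleHeight j) ^ 2 = 1 := by
  fin_cases i <;> fin_cases j <;> simp [triangleHeight] at h ⊢ <;> norm_num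

/-- The Minkowski sum of the vertex sets of two unit equilateral triangles in perpendicular planes,
pointing in opposite directions along the common line of these planes. -/
noncomputable def gridPoint (i j : Fin 3) : EuclideanSpace ℝ (Fin 3) :=
  !₂[√3 * (|triangleHeight i| - |triangleHeight j|), triangleHeight i, triangleHeight j]

theorem gridPoint_dist_row (i : Fin 3) {j j' : Fin 3} (h : j ≠ j') :
    dist (gridPoint i j) (gridPoint i j') = 1 := by
  have h3 : √3 ^ 2 = (3 : ℝ) := Real.sq_sqrt (by norm_num)
  rw [EuclideanSpace.dist_eq, Real.sqrt_eq_one]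
  simp only [Fin.sum_univ_three, Real.dist_eq, sq_abs]
  simp only [gridPoint, PiLp.toLp_apply, Matrix.cons_val]
  linear_combination triangleHeight_dist h
    + (|triangleHeight j| - |triangleHeight j'|) ^ 2 * h3

theorem gridPoint_dist_column (j : Fin 3) {i i' : Fin 3} (h : i ≠ i') :
    dist (gridPoint i j) (gridPoint i' j) = 1 := by
  have h3 : √3 ^ 2 = (3 : ℝ) := Real.sq_sqrt (by norm_num)
  rw [EuclideanSpace.dist_eq, Real.sqrt_eq_one]
  simp only [Fin.sum_univ_three, Real.dist_eq, sq_abs]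
  simp only [gridPoint, PiLp.toLp_apply, Matrix.cons_val]
  linear_combination triangleHeight_dist h
    + (|triangleHeight i| - |triangleHeight i'|) ^ 2 * h3

theorem convexHull_row_subset (i : Fin 3) :
    convexHull ℝ {gridPoint i 0, gridPoint i 1, gridPoint i 2} ⊆
      {x | x 1 = triangleHeight i ∧ x 0 ≤ √3 * (|triangleHeight i| - |x 2|)} := by
  refine convexHull_min ?_ ?_
  · rintro x (rfl | rfl | rfl) <;> simp [gridPoint]
  · rintro x ⟨hx, hx'⟩ z ⟨hz, hz'⟩ s t hs ht hst
    refine ⟨?_, ?_⟩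
    · simp only [PiLp.add_apply, PiLp.smul_apply, smul_eq_mul, hx, hz]
      rw [← add_mul, hst, one_mul]
    · simp only [PiLp.add_apply, PiLp.smul_apply, smul_eq_mul]
      have habs : |s * x 2 + t * z 2| ≤ s * |x 2| + t * |z 2| := by
        simpa [abs_mul, abs_of_nonneg hs, abs_of_nonneg ht] using abs_add_le (s * x 2) (t * z 2)
      calc s * x 0 + t * z 0
          ≤ s * (√3 * (|triangleHeight i| - |x 2|))
            + t * (√3 * (|triangleHeight i| - |z 2|)) := by gcongr
        _ = √3 * (|triangleHeight i| - (s * |x 2| + t * |z 2|)) := by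
            linear_combination √3 * |triangleHeight i| * hst
        _ ≤ √3 * (|triangleHeight i| - |s * x 2 + t * z 2|) := by gcongr

theorem convexHull_column_subset (j : Fin 3) :
    convexHull ℝ {gridPoint 0 j, gridPoint 1 j, gridPoint 2 j} ⊆
      {x | x 2 = triangleHeight j ∧ √3 * (|x 1| - |triangleHeight j|) ≤ x 0} := by
  refine convexHull_min ?_ ?_
  · rintro x (rfl | rfl | rfl) <;> simp [gridPoint]
  · rintro x ⟨hx, hx'⟩ z ⟨hz, hz'⟩ s t hs ht hst
    refine ⟨?_, ?_⟩
    · simp only [PiLp.add_apply, PiLp.smul_apply, smul_eq_mul, hx, hz]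
      rw [← add_mul, hst, one_mul]
    · simp only [PiLp.add_apply, PiLp.smul_apply, smul_eq_mul]
      have habs : |s * x 1 + t * z 1| ≤ s * |x 1| + t * |z 1| := by
        simpa [abs_mul, abs_of_nonneg hs, abs_of_nonneg ht] using abs_add_le (s * x 1) (t * z 1)
      calc √3 * (|s * x 1 + t * z 1| - |triangleHeight j|)
          ≤ √3 * (s * |x 1| + t * |z 1| - |triangleHeight j|) := by gcongr
        _ = s * (√3 * (|x 1| - |triangleHeight j|))
            + t * (√3 * (|z 1| - |triangleHeight j|)) := by
            linear_combination √3 * |triangleHeight j| * hst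
        _ ≤ s * x 0 + t * z 0 := by gcongr


/-- `K₃,₃` admits a contact representation in 3D by unit equilateral
triangles: there are nine pairwise distinct points `a i j` (`i` indexing the three
"row" triangles `T i`, `j` indexing the three "column" triangles `S j`) such that each
`T i = conv {a i 0, a i 1, a i 2}` and each `S j = conv {a 0 j, a 1 j, a 2 j}` is a unit
equilateral triangle, `T i ∩ S j = {a i j}`, and triangles on the same side are disjoint. -/
theorem K33_unit_equilateral_triangles :
    ∃ a : Fin 3 → Fin 3 → EuclideanSpace ℝ (Fin 3),
      -- the nine points are pairwise distinct
      (∀ i j i' j', a i j = a i' j' → i = i' ∧ j = j') ∧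
      -- each T i is a unit equilateral triangle
      (∀ i j j', j ≠ j' → dist (a i j) (a i j') = 1) ∧
      -- each S j is a unit equilateral triangle
      (∀ j i i', i ≠ i' → dist (a i j) (a i' j) = 1) ∧
      -- T i ∩ S j = {a i j}
      (∀ i j, convexHull ℝ {a i 0, a i 1, a i 2} ∩
        convexHull ℝ {a 0 j, a 1 j, a 2 j} = {a i j}) ∧
      -- the T triangles are pairwise disjoint
      (∀ i i', i ≠ i' → convexHull ℝ {a i 0, a i 1, a i 2} ∩
        convexHull ℝ {a i' 0, a i' 1, a i' 2} = ∅) ∧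
      -- the S triangles are pairwise disjoint
      (∀ j j', j ≠ j' → convexHull ℝ {a 0 j, a 1 j, a 2 j} ∩
        convexHull ℝ {a 0 j', a 1 j', a 2 j'} = ∅) := by
  refine ⟨gridPoint, ?_, fun i j j' => gridPoint_dist_row i, fun j i i' => gridPoint_dist_column j,
    ?_, ?_, ?_⟩
  · intro i j i' j' h
    exact ⟨triangleHeight_injective (by simpa [gridPoint] using congrArg (fun x => x 1) h),
      triangleHeight_injective (by simpa [gridPoint] using congrArg (fun x => x 2) h)⟩
  · intro i j
    refine Set.Subset.antisymm ?_ (Set.singleton_subset_iff.2 ⟨?_, ?_⟩)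
    · rintro x ⟨hrow, hcol⟩
      obtain ⟨h1, hle⟩ := convexHull_row_subset i hrow
      obtain ⟨h2, hge⟩ := convexHull_column_subset j hcol
      rw [h2] at hle
      rw [h1] at hge
      have h0 := le_antisymm hle hge
      ext k
      fin_cases k <;> simp [gridPoint, h0, h1, h2]
    · exact subset_convexHull ℝ _ (by fin_cases j <;> simp)
    · exact subset_convexHull ℝ _ (by fin_cases i <;> simp)
  · refine fun i i' hne => Set.eq_empty_of_forall_notMem fun x ⟨h, h'⟩ => hne ?_
    exact triangleHeight_injective
      ((convexHull_row_subset i h).1.symm.trans (convexHull_row_subset i' h').1)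
  · refine fun j j' hne => Set.eq_empty_of_forall_notMem fun x ⟨h, h'⟩ => hne ?_
    exact triangleHeight_injective
      ((convexHull_column_subset j h).1.symm.trans (convexHull_column_subset j' h').1)
end
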